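/- arXiv:1908.11097 — 2 statements merged into one kernel-verified Lean document; each statement's English description precedes it below -/
import Mathlib

section
/- For real x ≥ 0, define w(x) = (2i/π) · Log( (1 − i·e^{πx/2}) / (e^{πx/2} − i) ), where Log denotes the principal branch of the complex logarithm. Then w(x) is a real number in [0,1), and it satisfies the two-sided bound (4/π) e^{−πx/2} − (4/π − 1) e^{−πx} ≤ 1 − w(x) ≤ (4/π) e^{−πx/2} for all x ≥ 0. -/
open Complex Real

/-- On `[0, 1]` the arctangent dominates the quadratic `t - (1 - π / 4) t ^ 2`, which
agrees with it at both endpoints. -/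
lemma sub_mul_sq_le_arctan {t : ℝ} (h0 : 0 ≤ t) (h1 : t ≤ 1) :
    t - (1 - π / 4) * t ^ 2 ≤ Real.arctan t := by
  set f : ℝ → ℝ := fun u => Real.arctan u - u + (1 - π / 4) * u ^ 2 with hf
  have hd (u : ℝ) : HasDerivAt f (u * (2 * (1 - π / 4) - u / (1 + u ^ 2))) u := by
    refine (((Real.hasDerivAt_arctan u).sub (hasDerivAt_id u)).add
      ((hasDerivAt_pow 2 u).const_mul (1 - π / 4))).congr_deriv ?_
    have : 1 + u ^ 2 ≠ 0 := by positivity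
    field_simp
    ring
  have hc : Continuous f := continuous_iff_continuousAt.2 fun u => (hd u).continuousAt
  have hmono {u v : ℝ} (hu : 0 ≤ u) (huv : u ≤ v) (hv : v ≤ 1) :
      u / (1 + u ^ 2) ≤ v / (1 + v ^ 2) := by
    rw [div_le_div_iff₀ (by positivity) (by positivity)]
    nlinarith [mul_nonneg (sub_nonneg.2 huv)
      (sub_nonneg.2 (mul_le_one₀ (huv.trans hv) (hu.trans huv) hv))]
  suffices 0 ≤ f t by simp only [hf] at this; linarith
  rcases le_total (t / (1 + t ^ 2)) (2 * (1 - π / 4)) with h | h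
  · have hm : MonotoneOn f (Set.Icc 0 t) := by
      refine monotoneOn_of_deriv_nonneg (convex_Icc 0 t) hc.continuousOn
        (fun u _ => (hd u).differentiableAt.differentiableWithinAt) fun u hu => ?_
      rw [interior_Icc] at hu
      rw [(hd u).deriv]
      exact mul_nonneg hu.1.le (sub_nonneg.2 ((hmono hu.1.le hu.2.le h1).trans h))
    have := hm (Set.left_mem_Icc.2 h0) (Set.right_mem_Icc.2 h0) h0
    simpa [hf] using this
  · have hm : AntitoneOn f (Set.Icc t 1) := by
      refine antitoneOn_of_deriv_nonpos (convex_Icc t 1) hc.continuousOn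
        (fun u _ => (hd u).differentiableAt.differentiableWithinAt) fun u hu => ?_
      rw [interior_Icc] at hu
      rw [(hd u).deriv]
      exact mul_nonpos_of_nonneg_of_nonpos (h0.trans hu.1.le)
        (sub_nonpos.2 (h.trans (hmono h0 hu.1.le hu.2.le)))
    have := hm (Set.left_mem_Icc.2 h1) (Set.right_mem_Icc.2 h1) h1
    have h1' : f 1 = 0 := by simp only [hf, Real.arctan_one]; ring
    rwa [h1'] at this

lemma arctan_le_self_of_nonneg {t : ℝ} (h0 : 0 ≤ t) : Real.arctan t ≤ t := by
  have hm : Monotone fun u : ℝ => u - Real.arctan u := by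
    have hd (u : ℝ) : HasDerivAt (fun u : ℝ => u - Real.arctan u) (1 - 1 / (1 + u ^ 2)) u :=
      (hasDerivAt_id u).sub (Real.hasDerivAt_arctan u)
    refine monotone_of_deriv_nonneg (fun u => (hd u).differentiableAt) fun u => ?_
    rw [(hd u).deriv, sub_nonneg, div_le_one (by positivity)]
    nlinarith [sq_nonneg u]
  simpa using hm h0

/-- The Möbius image of a positive real, written in polar form. -/
lemma one_sub_I_mul_div_sub_I {E : ℝ} (hE : 0 < E) :
    (1 - Complex.I * E) / (E - Complex.I) =
      Complex.exp (((2 * Real.arctan E⁻¹ - π / 2 : ℝ) : ℂ) * Complex.I) := by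
  have hne : (E : ℂ) - Complex.I ≠ 0 := fun h => by
    have := congrArg Complex.im h
    simp at this
  set φ := Real.arctan E⁻¹ with hφ
  have hcos : Real.cos φ = Real.sin φ * E := by
    have h := Real.tan_arctan E⁻¹
    rw [← hφ, Real.tan_eq_sin_div_cos, div_eq_iff (Real.cos_arctan_pos _).ne'] at h
    rw [h, ← hφ]
    field_simp
  have hexp : Complex.exp (((2 * φ - π / 2 : ℝ) : ℂ) * Complex.I) =
      (Real.cos φ + Real.sin φ * Complex.I) ^ 2 * -Complex.I := by
    have : ((2 * φ - π / 2 : ℝ) : ℂ) * Complex.I =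
        (2 : ℕ) * (φ * Complex.I) + -(π / 2 * Complex.I) := by push_cast; ring
    rw [this, Complex.exp_add, Complex.exp_nat_mul, Complex.exp_neg,
      Complex.exp_pi_div_two_mul_I, Complex.inv_I, Complex.exp_mul_I]
    push_cast
    rfl
  have hs : (Real.sin φ : ℂ) ^ 2 * (E ^ 2 + 1) = 1 := by
    have h := Real.sin_sq_add_cos_sq φ
    rw [hcos] at h
    have h' : Real.sin φ ^ 2 * (E ^ 2 + 1) = 1 := by linear_combination h
    exact_mod_cast h'
  rw [hexp, div_eq_iff hne, hcos]
  push_cast at hs ⊢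
  linear_combination (-(1 - Complex.I * E)) * hs +
    Complex.sin φ ^ 2 * (E ^ 2 - Complex.I * E - Complex.I ^ 2 + 1) * Complex.I_sq

/-- The sharpened estimate (4.3) of the paper for the conformal map from the
half-strip to the unit-width strip.  For real `x ≥ 0`, the value
`w(x) = (2i/π) Log((1 - i e^{πx/2})/(e^{πx/2} - i))` (principal logarithm) is a real
number in `[0,1)`, and `(4/π) e^{-πx/2} - (4/π - 1) e^{-πx} ≤ 1 - w(x) ≤ (4/π) e^{-πx/2}`. -/
theorem conformal_map_estimate
    (x : ℝ) (hx : 0 ≤ x)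
    (w : ℂ)
    (hw : w = (2 * Complex.I / (π : ℂ)) *
        Complex.log ((1 - Complex.I * Complex.exp ((π : ℂ) * x / 2)) /
          (Complex.exp ((π : ℂ) * x / 2) - Complex.I))) :
    w.im = 0 ∧ 0 ≤ w.re ∧ w.re < 1 ∧
    (4 / π) * Real.exp (-π * x / 2) - (4 / π - 1) * Real.exp (-π * x) ≤ 1 - w.re ∧
    1 - w.re ≤ (4 / π) * Real.exp (-π * x / 2) := by
  have hπ := Real.pi_pos
  set t := Real.exp (-π * x / 2) with ht
  have ht0 : 0 < t := Real.exp_pos _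
  have ht1 : t ≤ 1 := by
    rw [ht, Real.exp_le_one_iff]
    nlinarith [mul_nonneg hπ.le hx]
  have ht2 : Real.exp (-π * x) = t ^ 2 := by
    rw [ht, ← Real.exp_nat_mul]
    congr 1
    push_cast
    ring
  have hinv : (Real.exp (π * x / 2))⁻¹ = t := by
    rw [ht, ← Real.exp_neg]
    congr 1
    ring
  have hφ0 : 0 < Real.arctan t := Real.arctan_pos.2 ht0
  have hφ1 : Real.arctan t ≤ π / 4 := by
    rw [← Real.arctan_one]
    exact Real.arctan_strictMono.monotone ht1
  have hw' : w = ((1 - 4 / π * Real.arctan t : ℝ) : ℂ) := by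
    have hE : Complex.exp ((π : ℂ) * x / 2) = (Real.exp (π * x / 2) : ℝ) := by push_cast; rfl
    have hπ' : (π : ℂ) ≠ 0 := by exact_mod_cast hπ.ne'
    rw [hw, hE, one_sub_I_mul_div_sub_I (Real.exp_pos _), hinv, Complex.log_exp]
    · push_cast
      field_simp
      rw [Complex.I_sq]
      ring
    · simp only [Complex.mul_im, Complex.ofReal_re, Complex.ofReal_im, Complex.I_re,
        Complex.I_im]
      linarith
    · simp only [Complex.mul_im, Complex.ofReal_re, Complex.ofReal_im, Complex.I_re,
        Complex.I_im]
      linarith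
  rw [hw', Complex.ofReal_re, Complex.ofReal_im, ht2]
  have h4 : 0 < 4 / π := by positivity
  have hcancel : 4 / π * (π / 4) = 1 := by field_simp
  refine ⟨rfl, ?_, ?_, ?_, ?_⟩
  · linarith [mul_le_mul_of_nonneg_left hφ1 h4.le]
  · linarith [mul_pos h4 hφ0]
  · have h := mul_le_mul_of_nonneg_left (sub_mul_sq_le_arctan ht0.le ht1) h4.le
    linear_combination h - t ^ 2 * hcancel
  · linarith [mul_le_mul_of_nonneg_left (arctan_le_self_of_nonneg ht0.le) h4.le]
end

section
/- For all real numbers r with 0 < r < 1/2 and h with 0 < h < 1/4, the following strict inequality holds: 1 − log(1 + h/r)/log(1/r) > exp( (−h − 2h²) / (r·log(1/r)) ). -/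
open Real

/-- Concavity of `negMulLog` between `r` and `1` bounds its decay to the right of `r`. -/
lemma negMulLog_lt_one_add_mul_negMulLog_add
    {r s : ℝ} (hr0 : 0 < r) (hr : r < 1 / 2) (hs0 : 0 < s) (hs : s < 1 / 4) :
    negMulLog r < (1 + 4 * s) * negMulLog (r + s) := by
  have h1r : 0 < 1 - r := by linarith
  have hφ : 0 < negMulLog r := by
    have := mul_pos hr0 (neg_pos.2 (log_neg hr0 (by linarith)))
    simp only [negMulLog]
    linarith
  have hq : s / (1 - r) < 2 * s := by
    rw [div_lt_iff₀ h1r]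
    nlinarith
  have hq0 : 0 < s / (1 - r) := by positivity
  have hc := concaveOn_negMulLog.2 (Set.mem_Ici.2 hr0.le) (Set.mem_Ici.2 zero_le_one)
    (by linarith : 0 ≤ 1 - s / (1 - r)) hq0.le (by ring)
  have he : (1 - s / (1 - r)) * r + s / (1 - r) * 1 = r + s := by
    field_simp
    ring
  simp only [smul_eq_mul, he, negMulLog_one, mul_zero, add_zero] at hc
  have hstep : (1 - 2 * s) * negMulLog r < negMulLog (r + s) := by nlinarith
  have hmul := mul_lt_mul_of_pos_left hstep (by linarith : 0 < 1 + 4 * s)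
  have hpos : 0 < s * (1 - 4 * s) * negMulLog r :=
    mul_pos (mul_pos hs0 (by linarith)) hφ
  nlinarith

/-- The logarithmic form of `chain_of_disks_inequality`. -/
lemma log_neg_log_lt_add_log_neg_log_add
    {r h : ℝ} (hr0 : 0 < r) (hr : r < 1 / 2) (hh0 : 0 < h) (hh : h < 1 / 4) :
    log (-log r) < (h + 2 * h ^ 2) / negMulLog r + log (-log (r + h)) := by
  have hlog : ∀ s ∈ Set.Icc 0 h, 0 < -log (r + s) := fun s hs =>
    neg_pos.2 (log_neg (by linarith [hs.1]) (by linarith [hs.2]))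
  have hd : ∀ s ∈ Set.Icc 0 h,
      HasDerivAt (fun s => (s + 2 * s ^ 2) / negMulLog r + log (-log (r + s)))
        ((1 + 4 * s) / negMulLog r - 1 / negMulLog (r + s)) s := by
    intro s hs
    have hrs : r + s ≠ 0 := by linarith [hs.1]
    have h1 : HasDerivAt (fun s : ℝ => s + 2 * s ^ 2) (1 + 4 * s) s := by
      refine ((hasDerivAt_id s).add (((hasDerivAt_id s).pow 2).const_mul 2)).congr_deriv ?_
      simp only [id]
      norm_num
      ring
    have h2 : HasDerivAt (fun s : ℝ => log (-log (r + s))) (-(1 / (r + s)) / -log (r + s)) s :=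
      ((((hasDerivAt_id s).const_add r).log hrs).neg).log (hlog s hs).ne'
    refine ((h1.div_const (negMulLog r)).add h2).congr_deriv ?_
    rw [sub_eq_add_neg, negMulLog.eq_def (r + s), neg_div, div_div, mul_neg, neg_mul]
  have hmono := strictMonoOn_of_deriv_pos (convex_Icc 0 h)
    (fun s hs => (hd s hs).continuousAt.continuousWithinAt) (by
      intro s hs
      rw [interior_Icc] at hs
      have hsm := Set.Ioo_subset_Icc_self hs
      rw [(hd s hsm).deriv, sub_pos]
      have hpos : ∀ t ∈ Set.Icc 0 h, 0 < negMulLog (r + t) := by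
        intro t ht
        have := mul_pos (by linarith [ht.1] : 0 < r + t) (hlog t ht)
        simp only [negMulLog]
        linarith
      have hr' := hpos 0 ⟨le_rfl, hh0.le⟩
      rw [add_zero] at hr'
      rw [div_lt_div_iff₀ (hpos s hsm) hr', one_mul]
      exact negMulLog_lt_one_add_mul_negMulLog_add hr0 hr hs.1 (hs.2.trans hh))
  simpa using hmono ⟨le_rfl, hh0.le⟩ ⟨hh0.le, le_rfl⟩ hh0

/-- The elementary real inequality underlying the inductive step of the paper's
Theorem 6: for `0 < r < 1/2` and `0 < h < 1/4`,
`1 - log(1 + h/r)/log(1/r) > exp((-h - 2h²)/(r log(1/r)))`. -/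
theorem chain_of_disks_inequality
    (r h : ℝ) (hr0 : 0 < r) (hr : r < 1 / 2) (hh0 : 0 < h) (hh : h < 1 / 4) :
    1 - Real.log (1 + h / r) / Real.log (1 / r) >
      Real.exp ((-h - 2 * h ^ 2) / (r * Real.log (1 / r))) := by
  have hL : 0 < -log r := neg_pos.2 (log_neg hr0 (by linarith))
  have hM : 0 < -log (r + h) := neg_pos.2 (log_neg (by linarith) (by linarith))
  have hlhs : 1 - log (1 + h / r) / log (1 / r) = -log (r + h) / -log r := by
    have : 1 + h / r = (r + h) / r := by field_simp
    rw [this, log_div (by positivity) hr0.ne', one_div, log_inv]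
    have hL' : log r ≠ 0 := neg_ne_zero.1 hL.ne'
    field_simp
    ring
  have hrhs : (-h - 2 * h ^ 2) / (r * log (1 / r)) = -((h + 2 * h ^ 2) / negMulLog r) := by
    rw [one_div, log_inv, negMulLog, mul_neg, neg_mul, ← neg_div]
    ring
  rw [gt_iff_lt, hlhs, hrhs, ← lt_log_iff_exp_lt (div_pos hM hL), log_div hM.ne' hL.ne']
  linarith [log_neg_log_lt_add_log_neg_log_add hr0 hr hh0 hh]
end
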